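/- For every $q\in\mathbb{R}$ and every $\varepsilon>0$, for $\nu_q$-almost every $x\in[0,1]$ the following holds: for every $\delta>0$ there exists $0<r<\delta$ such that $\nu_q(B(x,r))\le\nu(B(x,r))^q\,r^{\tau_\mu(q)-\varepsilon}$. -/

import Mathlib

open MeasureTheory Metric Set Filter Topology Classical
open scoped ENNReal NNReal

noncomputable section

namespace MF

/-! ### Olsen's multifractal measures and dimension functions on a metric space -/

variable {X : Type} [MetricSpace X]

/-- The sum `∑ m(B(xᵢ,rᵢ))^q (2rᵢ)^t` associated with a countable family of centered balls. -/
def olsenSum [MeasurableSpace X] (m : Measure X) (q t : ℝ) {ι : Type}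
    (c : ι → X) (r : ι → ℝ) : ℝ≥0∞ :=
  ∑' i, m (closedBall (c i) (r i)) ^ q * ENNReal.ofReal (2 * r i) ^ t

/-- `Olsen's 𝓗^{q,t}_{m,δ}`: infimum over countable centered `δ`-coverings of `E`. -/
def Hdel [MeasurableSpace X] (m : Measure X) (q t δ : ℝ) (E : Set X) : ℝ≥0∞ :=
  ⨅ (ι : Type) (_ : Countable ι) (c : ι → X) (r : ι → ℝ)
    (_ : ∀ i, c i ∈ E) (_ : ∀ i, 0 < r i ∧ r i ≤ δ)
    (_ : E ⊆ ⋃ i, closedBall (c i) (r i)), olsenSum m q t c r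

/-- Olsen's premeasure `𝓗̄^{q,t}_m` (limit, i.e. supremum, as `δ ↓ 0`). -/
def Hpre [MeasurableSpace X] (m : Measure X) (q t : ℝ) (E : Set X) : ℝ≥0∞ :=
  ⨆ (δ : ℝ) (_ : 0 < δ), Hdel m q t δ E

/-- Olsen's multifractal Hausdorff measure `𝓗^{q,t}_m`. -/
def Hmeas [MeasurableSpace X] (m : Measure X) (q t : ℝ) (E : Set X) : ℝ≥0∞ :=
  ⨆ (F : Set X) (_ : F ⊆ E), Hpre m q t F

/-- `𝓟̄^{q,t}_{m,δ}`: supremum over countable centered `δ`-packings of `E`. -/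
def Pdel [MeasurableSpace X] (m : Measure X) (q t δ : ℝ) (E : Set X) : ℝ≥0∞ :=
  ⨆ (ι : Type) (_ : Countable ι) (c : ι → X) (r : ι → ℝ)
    (_ : ∀ i, c i ∈ E) (_ : ∀ i, 0 < r i ∧ r i ≤ δ)
    (_ : ∀ i j, i ≠ j → Disjoint (closedBall (c i) (r i)) (closedBall (c j) (r j))),
    olsenSum m q t c r

/-- Olsen's packing premeasure `𝓟̄^{q,t}_m` (limit, i.e. infimum, as `δ ↓ 0`). -/
def Ppre [MeasurableSpace X] (m : Measure X) (q t : ℝ) (E : Set X) : ℝ≥0∞ :=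
  ⨅ (δ : ℝ) (_ : 0 < δ), Pdel m q t δ E

/-- Olsen's multifractal packing measure `𝓟^{q,t}_m`. -/
def Pmeas [MeasurableSpace X] (m : Measure X) (q t : ℝ) (E : Set X) : ℝ≥0∞ :=
  ⨅ (En : ℕ → Set X) (_ : E ⊆ ⋃ n, En n), ∑' n, Ppre m q t (En n)

/-- The (topological) support of a measure on a metric space. -/
def msupport [MeasurableSpace X] (m : Measure X) : Set X :=
  {x | ∀ r : ℝ, 0 < r → 0 < m (ball x r)}

/-- Olsen's multifractal Hausdorff dimension function `b_m`. -/
def bFun [MeasurableSpace X] (m : Measure X) (q : ℝ) : ℝ :=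
  sInf {t | Hmeas m q t (msupport m) = 0}

/-- Olsen's multifractal packing dimension function `B_m`. -/
def BFun [MeasurableSpace X] (m : Measure X) (q : ℝ) : ℝ :=
  sInf {t | Pmeas m q t (msupport m) = 0}

/-- Olsen's function `τ_m`. -/
def tauFun [MeasurableSpace X] (m : Measure X) (q : ℝ) : ℝ :=
  sInf {t | Ppre m q t (msupport m) = 0}

/-- `t`-dimensional packing pre-premeasure at scale `δ`. -/
def pPdel (t δ : ℝ) (E : Set X) : ℝ≥0∞ :=
  ⨆ (ι : Type) (_ : Countable ι) (c : ι → X) (r : ι → ℝ)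
    (_ : ∀ i, c i ∈ E) (_ : ∀ i, 0 < r i ∧ r i ≤ δ)
    (_ : ∀ i j, i ≠ j → Disjoint (closedBall (c i) (r i)) (closedBall (c j) (r j))),
    ∑' i, ENNReal.ofReal (2 * r i) ^ t

/-- `t`-dimensional packing premeasure. -/
def pPpre (t : ℝ) (E : Set X) : ℝ≥0∞ := ⨅ (δ : ℝ) (_ : 0 < δ), pPdel t δ E

/-- `t`-dimensional packing measure. -/
def pPmeas (t : ℝ) (E : Set X) : ℝ≥0∞ :=
  ⨅ (En : ℕ → Set X) (_ : E ⊆ ⋃ n, En n), ∑' n, pPpre t (En n)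

/-- Packing dimension of a set. -/
def packDim (E : Set X) : ℝ := sInf {t | pPmeas t E = 0}

/-- The level set `X_m(α)` of points of the support where the local Hölder exponent is `α`. -/
def Xlev [MeasurableSpace X] (m : Measure X) (α : ℝ) : Set X :=
  {x | x ∈ msupport m ∧
    Tendsto (fun r => Real.log (m (closedBall x r)).toReal / Real.log r)
      (𝓝[>] (0 : ℝ)) (𝓝 α)}

/-- Legendre transform `f^*(x) = inf_y (xy + f(y))`. -/
def leg (f : ℝ → ℝ) (x : ℝ) : ℝ := ⨅ y : ℝ, (x * y + f y)

/-! ### The mixed symbolic space and inhomogeneous multinomial measures -/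

/-- `j` is an index governed by the first alphabet:
`T (2k-1) ≤ j < T (2k)` for some `k ≥ 1`. -/
def isA (T : ℕ → ℕ) (j : ℕ) : Prop :=
  ∃ k, 1 ≤ k ∧ T (2 * k - 1) ≤ j ∧ j < T (2 * k)

/-- The size of the alphabet at (0-based) position `n`, i.e. at paper index `j = n+1`. -/
def Yc (c₁ c₂ : ℕ) (T : ℕ → ℕ) (n : ℕ) : ℕ := if isA T (n + 1) then c₁ else c₂

/-- The mixed symbolic space `∂𝒜₁,₂* = ∏ⱼ Yⱼ`. -/
abbrev Omg (c₁ c₂ : ℕ) (T : ℕ → ℕ) : Type := ∀ n : ℕ, Fin (Yc c₁ c₂ T n)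

/-- Finite words of length `n`. -/
abbrev Word (c₁ c₂ : ℕ) (T : ℕ → ℕ) (n : ℕ) : Type :=
  ∀ i : Fin n, Fin (Yc c₁ c₂ T i.val)

/-- `N_n`: the number of indices `1 ≤ j ≤ n` governed by the first alphabet. -/
def Ncount (T : ℕ → ℕ) (n : ℕ) : ℕ := ((Finset.Icc 1 n).filter (isA T)).card

/-- Diameter `c₁^{-N_n} c₂^{-(n-N_n)}` of a cylinder of generation `n`. -/
def Dw (c₁ c₂ : ℕ) (T : ℕ → ℕ) (n : ℕ) : ℝ :=
  ((c₁ : ℝ) ^ Ncount T n * (c₂ : ℝ) ^ (n - Ncount T n))⁻¹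

/-- The cylinder `[w]` defined by a finite word `w`. -/
def cyl (c₁ c₂ : ℕ) (T : ℕ → ℕ) (n : ℕ) (w : Word c₁ c₂ T n) : Set (Omg c₁ c₂ T) :=
  {x | ∀ i : Fin n, x i.val = w i}

/-- The mass `∏_{j≤n} p_j` given to the cylinder `[w]` by the inhomogeneous
multinomial measure with weights `a` and `b`. -/
def cylWeight (c₁ c₂ : ℕ) (T : ℕ → ℕ) (a b : ℕ → ℝ) (n : ℕ) (w : Word c₁ c₂ T n) : ℝ :=
  ∏ i : Fin n, (if isA T (i.val + 1) then a (w i).val else b (w i).val)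

/-- `θ(q) = log_c (p₁^q + ⋯ + p_c^q)`. -/
def theta (c : ℕ) (p : ℕ → ℝ) (q : ℝ) : ℝ :=
  Real.logb c (∑ i ∈ Finset.range c, p i ^ q)

/-- `τ_{μ,n}(q)`, defined by `∑_{z ∈ 𝒜₁,₂ⁿ} μ([z])^q = |w|^{-τ_{μ,n}(q)}`. -/
def tauN (c₁ c₂ : ℕ) (T : ℕ → ℕ) (a b : ℕ → ℝ) (q : ℝ) (n : ℕ) : ℝ :=
  Real.log (∑ z : Word c₁ c₂ T n, cylWeight c₁ c₂ T a b n z ^ q) /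
    Real.log ((c₁ : ℝ) ^ Ncount T n * (c₂ : ℝ) ^ (n - Ncount T n))

/-- The natural projection `γ : ∂𝒜₁,₂* → [0,1]`,
`γ(ε₁ε₂⋯) = ∑_{n≥1} εₙ c₁^{-N_n} c₂^{-(n-N_n)}`. -/
def gammaMap (c₁ c₂ : ℕ) (T : ℕ → ℕ) (x : Omg c₁ c₂ T) : ℝ :=
  ∑' n : ℕ, ((x n).val : ℝ) * Dw c₁ c₂ T (n + 1)

/-- The normalized weights `pᵢ^q / (p₁^q + ⋯ + p_c^q)`. -/
def taW (c : ℕ) (p : ℕ → ℝ) (q : ℝ) (i : ℕ) : ℝ :=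
  p i ^ q / ∑ j ∈ Finset.range c, p j ^ q

/-- `s₁ = min{max aᵢ, max bⱼ}`. -/
def sOne (c₁ c₂ : ℕ) (a b : ℕ → ℝ) : ℝ :=
  min (sSup {x | ∃ i < c₁, a i = x}) (sSup {x | ∃ j < c₂, b j = x})

/-- `s₂ = max{min aᵢ, min bⱼ}`. -/
def sTwo (c₁ c₂ : ℕ) (a b : ℕ → ℝ) : ℝ :=
  max (sInf {x | ∃ i < c₁, a i = x}) (sInf {x | ∃ j < c₂, b j = x})

/-- Entropy `h(p) = -∑_{i<2} pᵢ log₂ pᵢ`. -/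
def hEnt (p : ℕ → ℝ) : ℝ := -(∑ i ∈ Finset.range 2, p i * Real.logb 2 (p i))

/-! ### Dyadic intervals -/

/-- The family `𝓕_n` of dyadic intervals of generation `n` in `[0,1]`. -/
def Fnfam (n : ℕ) : Set (Set ℝ) :=
  {I | ∃ j : ℕ, j < 2 ^ n ∧ I = Set.Icc ((j : ℝ) / 2 ^ n) (((j : ℝ) + 1) / 2 ^ n)}

/-- Index of the dyadic interval of generation `n` containing `x`
(the left one when `x` is dyadic). -/
def dyadIdx (n : ℕ) (x : ℝ) : ℤ := ⌈x * 2 ^ n⌉ - 1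

/-- `I_n(x)`: the dyadic interval of generation `n` containing `x`
(the left one when `x` is dyadic). -/
def Idyad (n : ℕ) (x : ℝ) : Set ℝ :=
  Set.Icc ((dyadIdx n x : ℝ) / 2 ^ n) (((dyadIdx n x : ℝ) + 1) / 2 ^ n)

/-- `I_n(x)⁺`: the right neighbour of `I_n(x)` in `𝓕_n`. -/
def IdyadP (n : ℕ) (x : ℝ) : Set ℝ :=
  Set.Icc (((dyadIdx n x : ℝ) + 1) / 2 ^ n) (((dyadIdx n x : ℝ) + 2) / 2 ^ n)

/-- `I_n(x)⁻`: the left neighbour of `I_n(x)` in `𝓕_n`. -/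
def IdyadM (n : ℕ) (x : ℝ) : Set ℝ :=
  Set.Icc (((dyadIdx n x : ℝ) - 1) / 2 ^ n) ((dyadIdx n x : ℝ) / 2 ^ n)

/-! ### Cylinder diameters -/

lemma Ncount_succ (T : ℕ → ℕ) (n : ℕ) :
    Ncount T (n + 1) = Ncount T n + if isA T (n + 1) then 1 else 0 := by
  simp only [Ncount, Finset.card_filter]
  exact Finset.sum_Icc_succ_top (by omega) _

lemma Ncount_le (T : ℕ → ℕ) (n : ℕ) : Ncount T n ≤ n := by
  simpa [Ncount] using Finset.card_filter_le (Finset.Icc 1 n) (isA T)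

section Diameters

variable {c₁ c₂ : ℕ} {T : ℕ → ℕ}

lemma two_le_Yc (hc₁ : 2 ≤ c₁) (hc₂ : 2 ≤ c₂) (n : ℕ) : 2 ≤ Yc c₁ c₂ T n := by
  unfold Yc; split_ifs <;> assumption

lemma Yc_le_max (n : ℕ) : Yc c₁ c₂ T n ≤ max c₁ c₂ := by
  unfold Yc; split_ifs <;> simp

lemma Dw_zero : Dw c₁ c₂ T 0 = 1 := by
  simp [Dw, Ncount]

lemma Dw_pos (hc₁ : 2 ≤ c₁) (hc₂ : 2 ≤ c₂) (n : ℕ) : 0 < Dw c₁ c₂ T n := by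
  unfold Dw; positivity

lemma Dw_eq_mul_succ (hc₁ : 2 ≤ c₁) (hc₂ : 2 ≤ c₂) (n : ℕ) :
    Dw c₁ c₂ T n = Yc c₁ c₂ T n * Dw c₁ c₂ T (n + 1) := by
  have h₁ : (c₁ : ℝ) ≠ 0 := by positivity
  have h₂ : (c₂ : ℝ) ≠ 0 := by positivity
  have hN := Ncount_le T n
  unfold Dw Yc
  rw [Ncount_succ]
  split_ifs
  · rw [show n + 1 - (Ncount T n + 1) = n - Ncount T n by omega, pow_succ]
    field_simp
  · rw [show n + 1 - (Ncount T n + 0) = n - Ncount T n + 1 by omega, pow_succ, add_zero]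
    field_simp

lemma two_mul_Dw_succ_le (hc₁ : 2 ≤ c₁) (hc₂ : 2 ≤ c₂) (n : ℕ) :
    2 * Dw c₁ c₂ T (n + 1) ≤ Dw c₁ c₂ T n := by
  rw [Dw_eq_mul_succ hc₁ hc₂ n]
  have : (2 : ℝ) ≤ Yc c₁ c₂ T n := by exact_mod_cast two_le_Yc hc₁ hc₂ n
  have := Dw_pos (T := T) hc₁ hc₂ (n + 1)
  gcongr

lemma Dw_strictAnti (hc₁ : 2 ≤ c₁) (hc₂ : 2 ≤ c₂) : StrictAnti (Dw c₁ c₂ T) :=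
  strictAnti_nat_of_succ_lt fun n => by
    linarith [two_mul_Dw_succ_le (T := T) hc₁ hc₂ n, Dw_pos (T := T) hc₁ hc₂ (n + 1)]

lemma Dw_le_half_pow (hc₁ : 2 ≤ c₁) (hc₂ : 2 ≤ c₂) (n : ℕ) :
    Dw c₁ c₂ T n ≤ (1 / 2) ^ n := by
  induction n with
  | zero => simp [Dw_zero]
  | succ n ih =>
    rw [pow_succ]
    linarith [two_mul_Dw_succ_le (T := T) hc₁ hc₂ n]

lemma Dw_le_pow_mul (hc₁ : 2 ≤ c₁) (hc₂ : 2 ≤ c₂) (n k : ℕ) :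
    Dw c₁ c₂ T n ≤ (max c₁ c₂ : ℕ) ^ k * Dw c₁ c₂ T (n + k) := by
  induction k with
  | zero => simp
  | succ k ih =>
    refine ih.trans ?_
    rw [Dw_eq_mul_succ hc₁ hc₂ (n + k), pow_succ, mul_assoc, ← add_assoc]
    have := Dw_pos (T := T) hc₁ hc₂ (n + k + 1)
    have : (Yc c₁ c₂ T (n + k) : ℝ) ≤ (max c₁ c₂ : ℕ) := by exact_mod_cast Yc_le_max (n + k)
    gcongr

end Diameters

/-! ### The projection `γ` -/

/-- The partial sums of the series defining `gammaMap`. -/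
def gammaSum (c₁ c₂ : ℕ) (T : ℕ → ℕ) (n : ℕ) (x : Omg c₁ c₂ T) : ℝ :=
  ∑ i ∈ Finset.range n, ((x i).val : ℝ) * Dw c₁ c₂ T (i + 1)

section Projection

variable {c₁ c₂ : ℕ} {T : ℕ → ℕ}

lemma gammaSum_succ (n : ℕ) (x : Omg c₁ c₂ T) :
    gammaSum c₁ c₂ T (n + 1) x = gammaSum c₁ c₂ T n x + (x n).val * Dw c₁ c₂ T (n + 1) :=
  Finset.sum_range_succ _ _

lemma gammaSum_congr {n : ℕ} {x y : Omg c₁ c₂ T} (h : ∀ i < n, x i = y i) :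
    gammaSum c₁ c₂ T n x = gammaSum c₁ c₂ T n y :=
  Finset.sum_congr rfl fun i hi => by rw [h i (Finset.mem_range.1 hi)]

lemma gammaSum_mono (hc₁ : 2 ≤ c₁) (hc₂ : 2 ≤ c₂) (x : Omg c₁ c₂ T) :
    Monotone fun n => gammaSum c₁ c₂ T n x :=
  monotone_nat_of_le_succ fun n => by
    have := Dw_pos (T := T) hc₁ hc₂ (n + 1)
    rw [gammaSum_succ]
    exact le_add_of_nonneg_right (by positivity)

lemma gammaSum_add_Dw_antitone (hc₁ : 2 ≤ c₁) (hc₂ : 2 ≤ c₂) (x : Omg c₁ c₂ T) :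
    Antitone fun n => gammaSum c₁ c₂ T n x + Dw c₁ c₂ T n :=
  antitone_nat_of_succ_le fun n => by
    have hD := Dw_pos (T := T) hc₁ hc₂ (n + 1)
    have hx : ((x n).val : ℝ) + 1 ≤ Yc c₁ c₂ T n := by exact_mod_cast (x n).isLt
    rw [gammaSum_succ, Dw_eq_mul_succ hc₁ hc₂ n]
    nlinarith

lemma hasSum_gammaMap (hc₁ : 2 ≤ c₁) (hc₂ : 2 ≤ c₂) (x : Omg c₁ c₂ T) :
    HasSum (fun n => ((x n).val : ℝ) * Dw c₁ c₂ T (n + 1)) (gammaMap c₁ c₂ T x) := by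
  refine (summable_of_sum_range_le (c := 1) (fun n => ?_) fun n => ?_).hasSum
  · have := Dw_pos (T := T) hc₁ hc₂ (n + 1)
    positivity
  · have h := gammaSum_add_Dw_antitone hc₁ hc₂ x (Nat.zero_le n)
    have := Dw_pos (T := T) hc₁ hc₂ n
    simp only [gammaSum, Dw_zero, Finset.range_zero, Finset.sum_empty] at h
    linarith

lemma tendsto_gammaSum (hc₁ : 2 ≤ c₁) (hc₂ : 2 ≤ c₂) (x : Omg c₁ c₂ T) :
    Tendsto (fun n => gammaSum c₁ c₂ T n x) atTop (𝓝 (gammaMap c₁ c₂ T x)) :=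
  (hasSum_gammaMap hc₁ hc₂ x).tendsto_sum_nat

lemma gammaSum_le_gammaMap (hc₁ : 2 ≤ c₁) (hc₂ : 2 ≤ c₂) (n : ℕ) (x : Omg c₁ c₂ T) :
    gammaSum c₁ c₂ T n x ≤ gammaMap c₁ c₂ T x :=
  (gammaSum_mono hc₁ hc₂ x).ge_of_tendsto (tendsto_gammaSum hc₁ hc₂ x) n

lemma gammaMap_le_gammaSum_add (hc₁ : 2 ≤ c₁) (hc₂ : 2 ≤ c₂) (n : ℕ) (x : Omg c₁ c₂ T) :
    gammaMap c₁ c₂ T x ≤ gammaSum c₁ c₂ T n x + Dw c₁ c₂ T n := by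
  refine le_of_tendsto (tendsto_gammaSum hc₁ hc₂ x) ?_
  filter_upwards [eventually_ge_atTop n] with k hk
  have h := gammaSum_add_Dw_antitone hc₁ hc₂ x hk
  have := Dw_pos (T := T) hc₁ hc₂ k
  simp only at h
  linarith

lemma measurable_gammaMap (hc₁ : 2 ≤ c₁) (hc₂ : 2 ≤ c₂) : Measurable (gammaMap c₁ c₂ T) := by
  refine measurable_of_tendsto_metrizable (f := gammaSum c₁ c₂ T) (fun n => ?_)
    (tendsto_pi_nhds.2 (tendsto_gammaSum hc₁ hc₂))
  refine Finset.measurable_sum _ fun i _ => Measurable.mul_const ?_ _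
  exact (measurable_of_finite fun d : Fin (Yc c₁ c₂ T i) => (d.val : ℝ)).comp
    (measurable_pi_apply i)

lemma abs_gammaMap_sub_le (hc₁ : 2 ≤ c₁) (hc₂ : 2 ≤ c₂) {n : ℕ} {x y : Omg c₁ c₂ T}
    (h : ∀ i < n, x i = y i) :
    |gammaMap c₁ c₂ T x - gammaMap c₁ c₂ T y| ≤ Dw c₁ c₂ T n := by
  have hs := gammaSum_congr h
  rw [abs_le]
  constructor <;>
  linarith [gammaSum_le_gammaMap hc₁ hc₂ n x, gammaSum_le_gammaMap hc₁ hc₂ n y,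
    gammaMap_le_gammaSum_add hc₁ hc₂ n x, gammaMap_le_gammaSum_add hc₁ hc₂ n y]

/-- If `x` precedes `y` lexicographically, first differing at `j`, and the later digits at `k` are
not the extremal pair, then `γ(x)` and `γ(y)` are separated by the diameter of generation
`k + 1`. -/
lemma gammaMap_add_Dw_le (hc₁ : 2 ≤ c₁) (hc₂ : 2 ≤ c₂) {x y : Omg c₁ c₂ T} {j k : ℕ}
    (hjk : j < k) (hagree : ∀ i < j, x i = y i) (hlt : x j < y j)
    (hk : (x k).val + 1 < Yc c₁ c₂ T k ∨ 0 < (y k).val) :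
    gammaMap c₁ c₂ T x + Dw c₁ c₂ T (k + 1) ≤ gammaMap c₁ c₂ T y := by
  have hsep : ∀ n, j + 1 ≤ n →
      gammaSum c₁ c₂ T n x + Dw c₁ c₂ T n ≤ gammaSum c₁ c₂ T n y := by
    intro n hn
    induction n, hn using Nat.le_induction with
    | base =>
      have hD := Dw_pos (T := T) hc₁ hc₂ (j + 1)
      have hxy : ((x j).val : ℝ) + 1 ≤ (y j).val := by exact_mod_cast hlt
      rw [gammaSum_succ, gammaSum_succ, gammaSum_congr hagree]
      nlinarith
    | succ n _ ih =>
      have h := gammaSum_add_Dw_antitone hc₁ hc₂ x n.le_succ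
      exact h.trans (ih.trans (gammaSum_mono hc₁ hc₂ y n.le_succ))
  have hD := Dw_pos (T := T) hc₁ hc₂ (k + 1)
  have hdig : ((x k).val : ℝ) + 2 ≤ Yc c₁ c₂ T k + (y k).val := by
    have := (x k).isLt
    exact_mod_cast (by omega : (x k).val + 2 ≤ Yc c₁ c₂ T k + (y k).val)
  have h := hsep k hjk
  rw [Dw_eq_mul_succ hc₁ hc₂ k] at h
  have hx := gammaMap_le_gammaSum_add hc₁ hc₂ (k + 1) x
  have hy := gammaSum_le_gammaMap hc₁ hc₂ (k + 1) y
  rw [gammaSum_succ] at hx hy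
  nlinarith

/-- The event that the digits at positions `n, …, n + k - 1` are prescribed by `s`. -/
def digitRun (c₁ c₂ : ℕ) (T : ℕ → ℕ) (s : ℕ → ℕ) (n k : ℕ) : Set (Omg c₁ c₂ T) :=
  {x | ∀ i, n ≤ i → i < n + k → (x i).val = s i}

lemma agree_of_abs_gammaMap_sub_le (hc₁ : 2 ≤ c₁) (hc₂ : 2 ≤ c₂) {n l : ℕ} {x y : Omg c₁ c₂ T}
    (hmin : x ∉ digitRun c₁ c₂ T (fun _ => 0) n (l - 1))
    (hmax : x ∉ digitRun c₁ c₂ T (fun i => Yc c₁ c₂ T i - 1) n (l - 1))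
    (h : |gammaMap c₁ c₂ T x - gammaMap c₁ c₂ T y| ≤ Dw c₁ c₂ T (n + l)) :
    ∀ i < n, x i = y i := by
  by_contra! hne
  have hj := Nat.find_spec hne
  have hagree : ∀ i < Nat.find hne, x i = y i := fun i hi => by
    have := Nat.find_min hne hi
    by_contra hxy
    exact this ⟨hi.trans hj.1, hxy⟩
  rw [abs_le] at h
  simp only [digitRun, mem_ofPred_eq, not_forall] at hmin hmax
  rcases lt_or_gt_of_ne hj.2 with hlt | hlt
  · obtain ⟨k, hnk, hkl, hk⟩ := hmax
    have hsep := gammaMap_add_Dw_le hc₁ hc₂ (hj.1.trans_le hnk) hagree hlt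
      (Or.inl (by have := (x k).isLt; omega))
    have := Dw_strictAnti (T := T) hc₁ hc₂ (show k + 1 < n + l by omega)
    linarith [h.1]
  · obtain ⟨k, hnk, hkl, hk⟩ := hmin
    have hsep := gammaMap_add_Dw_le hc₁ hc₂ (hj.1.trans_le hnk)
      (fun i hi => (hagree i hi).symm) hlt (Or.inr (by omega))
    have := Dw_strictAnti (T := T) hc₁ hc₂ (show k + 1 < n + l by omega)
    linarith [h.2]

end Projection

/-! ### Cylinder weights -/

/-- The weight of the digit `d` at position `i`. -/
def digitWeight (T : ℕ → ℕ) (a b : ℕ → ℝ) (i d : ℕ) : ℝ :=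
  if isA T (i + 1) then a d else b d

/-- The word formed by the first `n` digits of `x`. -/
def truncation {c₁ c₂ : ℕ} {T : ℕ → ℕ} (n : ℕ) (x : Omg c₁ c₂ T) : Word c₁ c₂ T n :=
  fun i => x i.val

section Weights

variable {c₁ c₂ : ℕ} {T : ℕ → ℕ} {a b : ℕ → ℝ}

lemma forall_digitWeight {P : ℝ → Prop} (ha : ∀ i < c₁, P (a i)) (hb : ∀ j < c₂, P (b j))
    {i d : ℕ} (hd : d < Yc c₁ c₂ T i) : P (digitWeight T a b i d) := by
  unfold digitWeight
  unfold Yc at hd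
  split_ifs at hd ⊢
  exacts [ha d hd, hb d hd]

lemma cylWeight_truncation_succ (n : ℕ) (x : Omg c₁ c₂ T) :
    cylWeight c₁ c₂ T a b (n + 1) (truncation (n + 1) x) =
      cylWeight c₁ c₂ T a b n (truncation n x) * digitWeight T a b n (x n).val := by
  simp [cylWeight, truncation, digitWeight, Fin.prod_univ_castSucc]

lemma cylWeight_pos (ha : ∀ i < c₁, 0 < a i) (hb : ∀ j < c₂, 0 < b j) (n : ℕ)
    (w : Word c₁ c₂ T n) : 0 < cylWeight c₁ c₂ T a b n w :=
  Finset.prod_pos fun i _ => forall_digitWeight ha hb (w i).isLt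

lemma pow_mul_cylWeight_le {p : ℝ} (hp : 0 ≤ p) (ha : ∀ i < c₁, 0 < a i) (hb : ∀ j < c₂, 0 < b j)
    (hpa : ∀ i < c₁, p ≤ a i) (hpb : ∀ j < c₂, p ≤ b j) (n k : ℕ) (x : Omg c₁ c₂ T) :
    p ^ k * cylWeight c₁ c₂ T a b n (truncation n x) ≤
      cylWeight c₁ c₂ T a b (n + k) (truncation (n + k) x) := by
  induction k with
  | zero => simp
  | succ k ih =>
    rw [← add_assoc, cylWeight_truncation_succ, pow_succ, mul_right_comm]
    have h₁ := forall_digitWeight (T := T) hpa hpb (x (n + k)).isLt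
    have h₂ := (cylWeight_pos (T := T) ha hb (n + k) (truncation (n + k) x)).le
    exact mul_le_mul ih h₁ hp h₂

lemma sum_cylWeight_rpow (ha : ∀ i < c₁, 0 < a i) (hb : ∀ j < c₂, 0 < b j) (q : ℝ) (n : ℕ) :
    ∑ z : Word c₁ c₂ T n, cylWeight c₁ c₂ T a b n z ^ q =
      ∏ i : Fin n, digitWeight T (fun _ => ∑ j ∈ Finset.range c₁, a j ^ q)
        (fun _ => ∑ j ∈ Finset.range c₂, b j ^ q) i.val 0 := by
  have h : ∀ i : Fin n, digitWeight T (fun _ => ∑ j ∈ Finset.range c₁, a j ^ q)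
        (fun _ => ∑ j ∈ Finset.range c₂, b j ^ q) i.val 0 =
      ∑ d : Fin (Yc c₁ c₂ T i.val), digitWeight T a b i.val d.val ^ q := by
    intro i
    rw [Fin.sum_univ_eq_sum_range (fun d => digitWeight T a b i.val d ^ q)]
    unfold digitWeight Yc
    split_ifs <;> rfl
  simp_rw [h]
  rw [Finset.prod_univ_sum, Fintype.piFinset_univ]
  refine Finset.sum_congr rfl fun z _ => ?_
  exact (Real.finsetProd_rpow _ _
    (fun i _ => (forall_digitWeight (T := T) ha hb (z i).isLt).le) q).symm

lemma cylWeight_taW (ha : ∀ i < c₁, 0 < a i) (hb : ∀ j < c₂, 0 < b j) (q : ℝ) (n : ℕ)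
    (w : Word c₁ c₂ T n) :
    cylWeight c₁ c₂ T (taW c₁ a q) (taW c₂ b q) n w =
      cylWeight c₁ c₂ T a b n w ^ q / ∑ z : Word c₁ c₂ T n, cylWeight c₁ c₂ T a b n z ^ q := by
  rw [sum_cylWeight_rpow ha hb]
  have h := Real.finsetProd_rpow Finset.univ (fun i : Fin n => digitWeight T a b i.val (w i).val)
    (fun i _ => (forall_digitWeight (T := T) ha hb (w i).isLt).le) q
  unfold cylWeight
  refine Eq.trans ?_ (congrArg (· / _) h)
  rw [← Finset.prod_div_distrib]
  refine Finset.prod_congr rfl fun i _ => ?_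
  unfold digitWeight taW
  split_ifs <;> rfl

lemma sum_rpow_pos {c : ℕ} (hc : 2 ≤ c) {p : ℕ → ℝ} (hp : ∀ i < c, 0 < p i) (q : ℝ) :
    0 < ∑ j ∈ Finset.range c, p j ^ q :=
  Finset.sum_pos (fun i hi => Real.rpow_pos_of_pos (hp i (Finset.mem_range.1 hi)) q)
    ⟨0, Finset.mem_range.2 (by omega)⟩

lemma taW_pos {c : ℕ} (hc : 2 ≤ c) {p : ℕ → ℝ} (hp : ∀ i < c, 0 < p i) (q : ℝ) :
    ∀ i < c, 0 < taW c p q i := fun i hi =>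
  div_pos (Real.rpow_pos_of_pos (hp i hi) q) (sum_rpow_pos hc hp q)

lemma taW_lt_one {c : ℕ} (hc : 2 ≤ c) {p : ℕ → ℝ} (hp : ∀ i < c, 0 < p i) (q : ℝ) :
    ∀ i < c, taW c p q i < 1 := by
  intro i hi
  rw [taW, div_lt_one (sum_rpow_pos hc hp q)]
  have hpos : ∀ j ∈ Finset.range c, 0 < p j ^ q := fun j hj =>
    Real.rpow_pos_of_pos (hp j (Finset.mem_range.1 hj)) q
  obtain ⟨j, hj, hji⟩ : ∃ j < c, j ≠ i := by
    by_cases h : i = 0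
    · exact ⟨1, by omega, by omega⟩
    · exact ⟨0, by omega, by omega⟩
  exact Finset.single_lt_sum hji (Finset.mem_range.2 hi) (Finset.mem_range.2 hj)
    (hpos j (Finset.mem_range.2 hj)) fun k hk _ => (hpos k hk).le

lemma exists_pos_le_forall_lt {f : ℕ → ℝ} (c : ℕ) (hf : ∀ i < c, 0 < f i) :
    ∃ p : ℝ, 0 < p ∧ ∀ i < c, p ≤ f i := by
  induction c with
  | zero => exact ⟨1, by simp⟩
  | succ c ih =>
    obtain ⟨p, hp, h⟩ := ih fun i hi => hf i (by omega)
    refine ⟨min p (f c), lt_min hp (hf c (by omega)), fun i hi => ?_⟩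
    rcases Nat.lt_succ_iff_lt_or_eq.1 hi with hi | rfl
    · exact (min_le_left _ _).trans (h i hi)
    · exact min_le_right _ _

lemma rpow_neg_tauN (hc₁ : 2 ≤ c₁) (hc₂ : 2 ≤ c₂) (ha : ∀ i < c₁, 0 < a i)
    (hb : ∀ j < c₂, 0 < b j) (q : ℝ) {n : ℕ} (hn : n ≠ 0) :
    ∑ z : Word c₁ c₂ T n, cylWeight c₁ c₂ T a b n z ^ q =
      Dw c₁ c₂ T n ^ (-tauN c₁ c₂ T a b q n) := by
  have hD := Dw_pos (T := T) hc₁ hc₂ n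
  have hD1 : Dw c₁ c₂ T n < 1 := by
    simpa [Dw_zero] using Dw_strictAnti (T := T) hc₁ hc₂ (Nat.pos_of_ne_zero hn)
  have hlog : Real.log (Dw c₁ c₂ T n) ≠ 0 := (Real.log_neg hD hD1).ne
  have hZ : 0 < ∑ z : Word c₁ c₂ T n, cylWeight c₁ c₂ T a b n z ^ q := by
    rw [sum_cylWeight_rpow ha hb]
    refine Finset.prod_pos fun i _ => ?_
    unfold digitWeight
    split_ifs
    exacts [sum_rpow_pos hc₁ ha q, sum_rpow_pos hc₂ hb q]
  have htau : tauN c₁ c₂ T a b q n =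
      Real.log (∑ z : Word c₁ c₂ T n, cylWeight c₁ c₂ T a b n z ^ q) /
        (-Real.log (Dw c₁ c₂ T n)) := by
    rw [tauN, Dw, Real.log_inv, neg_neg]
  rw [htau, Real.rpow_def_of_pos hD, div_neg, neg_neg, mul_div_cancel₀ _ hlog, Real.exp_log hZ]

lemma isBoundedUnder_ge_tauN (hc₁ : 2 ≤ c₁) (hc₂ : 2 ≤ c₂) (ha : ∀ i < c₁, 0 < a i)
    (hb : ∀ j < c₂, 0 < b j) (q : ℝ) :
    IsBoundedUnder (· ≥ ·) atTop (tauN c₁ c₂ T a b q) := by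
  set A := ∑ j ∈ Finset.range c₁, a j ^ q
  set B := ∑ j ∈ Finset.range c₂, b j ^ q
  set M := max |Real.log A| |Real.log B|
  have hM : 0 ≤ M := (abs_nonneg _).trans (le_max_left _ _)
  have hl2 : 0 < Real.log 2 := Real.log_pos one_lt_two
  refine isBoundedUnder_of ⟨-(M / Real.log 2), fun n => ?_⟩
  have hnum : -(n * M) ≤
      Real.log (∑ z : Word c₁ c₂ T n, cylWeight c₁ c₂ T a b n z ^ q) := by
    rw [sum_cylWeight_rpow ha hb, Real.log_prod]
    · have h : ∀ i ∈ (Finset.univ : Finset (Fin n)),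
          -M ≤ Real.log (digitWeight T (fun _ => A) (fun _ => B) i.val 0) := by
        intro i _
        unfold digitWeight
        split_ifs
        · exact (neg_le_neg (le_max_left _ _)).trans (neg_abs_le _)
        · exact (neg_le_neg (le_max_right _ _)).trans (neg_abs_le _)
      simpa using Finset.card_nsmul_le_sum _ _ _ h
    · intro i _
      unfold digitWeight
      split_ifs
      exacts [(sum_rpow_pos hc₁ ha q).ne', (sum_rpow_pos hc₂ hb q).ne']
  have hden : n * Real.log 2 ≤ Real.log ((c₁ : ℝ) ^ Ncount T n * (c₂ : ℝ) ^ (n - Ncount T n)) := by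
    have h := Real.log_le_log (Dw_pos (T := T) hc₁ hc₂ n) (Dw_le_half_pow hc₁ hc₂ n)
    rw [Dw, Real.log_inv, Real.log_pow, one_div, Real.log_inv] at h
    linarith
  have hdiv : n * M / Real.log ((c₁ : ℝ) ^ Ncount T n * (c₂ : ℝ) ^ (n - Ncount T n)) ≤
      M / Real.log 2 := by
    rcases Nat.eq_zero_or_pos n with rfl | hn
    · simp; positivity
    · have hn' : (0 : ℝ) < n := by exact_mod_cast hn
      rw [div_le_div_iff₀ ((mul_pos hn' hl2).trans_le hden) hl2]
      nlinarith
  have hden0 : 0 ≤ Real.log ((c₁ : ℝ) ^ Ncount T n * (c₂ : ℝ) ^ (n - Ncount T n)) :=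
    le_trans (by positivity) hden
  calc -(M / Real.log 2) ≤
      -(n * M) / Real.log ((c₁ : ℝ) ^ Ncount T n * (c₂ : ℝ) ^ (n - Ncount T n)) := by
        rw [neg_div]; exact neg_le_neg hdiv
    _ ≤ _ := div_le_div_of_nonneg_right hnum hden0

end Weights

/-! ### Cylinders and runs of digits -/

section Measures

variable {c₁ c₂ : ℕ} {T : ℕ → ℕ}

lemma mem_cyl_truncation_iff {n : ℕ} {x y : Omg c₁ c₂ T} :
    y ∈ cyl c₁ c₂ T n (truncation n x) ↔ ∀ i < n, x i = y i :=
  ⟨fun h i hi => (h ⟨i, hi⟩).symm, fun h i => (h i.val i.isLt).symm⟩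

lemma measurableSet_cyl (n : ℕ) (w : Word c₁ c₂ T n) : MeasurableSet (cyl c₁ c₂ T n w) := by
  rw [show cyl c₁ c₂ T n w = ⋂ i : Fin n, (fun x => x i.val) ⁻¹' {w i} by
    ext; simp [cyl]]
  exact MeasurableSet.iInter fun i => measurable_pi_apply i.val (measurableSet_singleton (w i))

lemma measurableSet_digitRun (s : ℕ → ℕ) (n k : ℕ) : MeasurableSet (digitRun c₁ c₂ T s n k) := by
  have : digitRun c₁ c₂ T s n k =
      ⋂ i, ⋂ (_ : n ≤ i), ⋂ (_ : i < n + k), (fun x : Omg c₁ c₂ T => x i) ⁻¹' {d | d.val = s i} := by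
    ext; simp [digitRun]
  rw [this]
  exact MeasurableSet.iInter fun i => MeasurableSet.iInter fun _ => MeasurableSet.iInter fun _ =>
    measurable_pi_apply i (Set.toFinite _).measurableSet

lemma measure_digitRun_le {a b : ℕ → ℝ} {m : Measure (Omg c₁ c₂ T)} [IsProbabilityMeasure m]
    (hm : ∀ (n : ℕ) (w : Word c₁ c₂ T n),
      m (cyl c₁ c₂ T n w) = ENNReal.ofReal (cylWeight c₁ c₂ T a b n w))
    (ha : ∀ i < c₁, 0 < a i) (hb : ∀ j < c₂, 0 < b j) {ρ : ℝ}
    (hρa : ∀ i < c₁, a i ≤ ρ) (hρb : ∀ j < c₂, b j ≤ ρ) (s : ℕ → ℕ) (n k : ℕ) :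
    m (digitRun c₁ c₂ T s n k) ≤ ENNReal.ofReal ρ ^ k := by
  induction k with
  | zero => simpa using prob_le_one
  | succ k ih =>
    have hstep : ∀ w : Word c₁ c₂ T (n + k),
        m (digitRun c₁ c₂ T s n (k + 1) ∩ cyl c₁ c₂ T (n + k) w) ≤
          ENNReal.ofReal ρ * m (digitRun c₁ c₂ T s n k ∩ cyl c₁ c₂ T (n + k) w) := by
      intro w
      rcases (digitRun c₁ c₂ T s n (k + 1) ∩ cyl c₁ c₂ T (n + k) w).eq_empty_or_nonempty with
        h | ⟨x, hx, hxw⟩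
      · simp [h]
      obtain rfl : truncation (n + k) x = w := funext hxw
      have hsub : digitRun c₁ c₂ T s n (k + 1) ∩ cyl c₁ c₂ T (n + k) (truncation (n + k) x) ⊆
          cyl c₁ c₂ T (n + k + 1) (truncation (n + k + 1) x) := by
        rintro y ⟨hy, hyw⟩
        rw [mem_cyl_truncation_iff] at hyw ⊢
        intro i hi
        rcases Nat.lt_succ_iff_lt_or_eq.1 hi with hi | rfl
        · exact hyw i hi
        · exact Fin.ext ((hx _ (by omega) (by omega)).trans (hy _ (by omega) (by omega)).symm)
      have hsup : cyl c₁ c₂ T (n + k) (truncation (n + k) x) ⊆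
          digitRun c₁ c₂ T s n k ∩ cyl c₁ c₂ T (n + k) (truncation (n + k) x) := by
        refine fun y hy => ⟨fun i hni hi => ?_, hy⟩
        rw [← mem_cyl_truncation_iff.1 hy i hi]
        exact hx i hni (by omega)
      calc _ ≤ m (cyl c₁ c₂ T (n + k + 1) (truncation (n + k + 1) x)) := measure_mono hsub
        _ = ENNReal.ofReal (digitWeight T a b (n + k) (x (n + k)).val) *
              m (cyl c₁ c₂ T (n + k) (truncation (n + k) x)) := by
            rw [hm, hm, cylWeight_truncation_succ, mul_comm,
              ENNReal.ofReal_mul (forall_digitWeight (T := T) ha hb (x (n + k)).isLt).le]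
        _ ≤ _ := by
            gcongr
            exact forall_digitWeight (T := T) (P := (· ≤ ρ)) hρa hρb (x (n + k)).isLt
    have hdisj : Pairwise (Function.onFun Disjoint fun w : Word c₁ c₂ T (n + k) =>
        digitRun c₁ c₂ T s n k ∩ cyl c₁ c₂ T (n + k) w) := by
      intro w w' hww
      refine Set.disjoint_left.2 fun x hx hx' => hww (funext fun i => ?_)
      rw [← hx.2 i, hx'.2 i]
    have hcover : digitRun c₁ c₂ T s n (k + 1) ⊆
        ⋃ w, digitRun c₁ c₂ T s n (k + 1) ∩ cyl c₁ c₂ T (n + k) w := fun x hx =>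
      mem_iUnion.2 ⟨truncation (n + k) x, hx, fun _ => rfl⟩
    calc m (digitRun c₁ c₂ T s n (k + 1))
        ≤ ∑ w, m (digitRun c₁ c₂ T s n (k + 1) ∩ cyl c₁ c₂ T (n + k) w) :=
          (measure_mono hcover).trans (measure_iUnion_fintype_le _ _)
      _ ≤ ∑ w, ENNReal.ofReal ρ * m (digitRun c₁ c₂ T s n k ∩ cyl c₁ c₂ T (n + k) w) :=
          Finset.sum_le_sum fun w _ => hstep w
      _ = ENNReal.ofReal ρ * m (⋃ w, digitRun c₁ c₂ T s n k ∩ cyl c₁ c₂ T (n + k) w) := by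
          rw [← Finset.mul_sum, measure_iUnion hdisj
            fun w => (measurableSet_digitRun s n k).inter (measurableSet_cyl _ w), tsum_fintype]
      _ ≤ ENNReal.ofReal ρ * ENNReal.ofReal ρ ^ k := by
          gcongr
          exact (measure_mono (iUnion_subset fun w => inter_subset_left)).trans ih
      _ = ENNReal.ofReal ρ ^ (k + 1) := (pow_succ' _ _).symm

/-- An event that fails with probability tending to zero occurs infinitely often along any
infinite set of indices. -/
lemma ae_frequently_of_tendsto_measure_zero {Ω : Type*} [MeasurableSpace Ω] {m : Measure Ω}
    {s : ℕ → Set Ω} (hs : Tendsto (fun n => m (s n)) atTop (𝓝 0)) {P : ℕ → Prop}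
    (hP : ∃ᶠ n in atTop, P n) : ∀ᵐ x ∂m, ∃ᶠ n in atTop, P n ∧ x ∉ s n := by
  simp_rw [frequently_atTop]
  refine ae_all_iff.2 fun N => ?_
  rw [ae_iff, ← nonpos_iff_eq_zero]
  refine le_of_forall_gt fun η hη => ?_
  obtain ⟨n, hPn, hn, hsn⟩ :=
    (hP.and_eventually ((eventually_ge_atTop N).and (hs.eventually_lt_const hη))).exists
  refine (measure_mono fun x hx => ?_).trans_lt hsn
  by_contra hxs
  exact hx ⟨n, hn, hPn, hxs⟩

end Measures

lemma measurable_measure_closedBall {m : Measure ℝ} [SFinite m] (r : ℝ) :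
    Measurable fun x => m (closedBall x r) :=
  measurable_measure_prodMk_left (s := {p : ℝ × ℝ | dist p.2 p.1 ≤ r})
    (measurableSet_le (measurable_snd.dist measurable_fst) measurable_const)

lemma rpow_mul_rpow_le {q t η τ W V D E p C : ℝ} {l n : ℕ} (hp : 0 < p) (hE : 0 < E)
    (hED : E ≤ D) (hDE : D ≤ C ^ l * E) (hC : 0 < C) (hW : 0 < W) (hWV : p ^ l * W ≤ V)
    (hVW : V ≤ W) (hD : D ≤ (1 / 2) ^ n) (hη : 0 ≤ η) (hτ : t + η ≤ τ)
    (hl : l * (|q| * -Real.log p + |t| * Real.log C) ≤ n * (η * Real.log 2)) :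
    W ^ q * D ^ τ ≤ V ^ q * E ^ t := by
  have hD0 : 0 < D := hE.trans_le hED
  have hV : 0 < V := (by positivity : 0 < p ^ l * W).trans_le hWV
  have h₁ : l * Real.log p + Real.log W ≤ Real.log V := by
    have := Real.log_le_log (by positivity) hWV
    rwa [Real.log_mul (by positivity) hW.ne', Real.log_pow] at this
  have h₂ := Real.log_le_log hV hVW
  have h₃ : Real.log D ≤ l * Real.log C + Real.log E := by
    have := Real.log_le_log hD0 hDE
    rwa [Real.log_mul (by positivity) hE.ne', Real.log_pow] at this
  have h₄ := Real.log_le_log hE hED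
  have h₅ : Real.log D ≤ -(n * Real.log 2) := by
    have := Real.log_le_log hD0 hD
    rwa [Real.log_pow, one_div, Real.log_inv, mul_neg] at this
  have hq : |q * (Real.log V - Real.log W)| ≤ |q| * (l * -Real.log p) := by
    rw [abs_mul]
    gcongr
    rw [abs_le]; constructor <;> linarith
  have ht : |t * (Real.log E - Real.log D)| ≤ |t| * (l * Real.log C) := by
    rw [abs_mul]
    gcongr
    rw [abs_le]; constructor <;> linarith
  have hn : 0 ≤ n * Real.log 2 := by positivity
  have hτD : η * (n * Real.log 2) ≤ (t - τ) * Real.log D := by nlinarith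
  rw [Real.rpow_def_of_pos hW, Real.rpow_def_of_pos hD0, Real.rpow_def_of_pos hV,
    Real.rpow_def_of_pos hE, ← Real.exp_add, ← Real.exp_add]
  refine Real.exp_le_exp.2 ?_
  linarith [(abs_le.1 hq).1, (abs_le.1 ht).1]

/-- first assertion of Lemma 4.6. -/
theorem stmt11 (c₁ c₂ : ℕ) (hc₁ : 2 ≤ c₁) (hc₂ : 2 ≤ c₂)
    (T : ℕ → ℕ) (hT1 : T 1 = 1) (hTmono : ∀ k, 1 ≤ k → T k < T (k + 1))
    (hTrat : Tendsto (fun k => (T (k + 1) : ℝ) / (T k : ℝ)) atTop atTop)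
    (a b : ℕ → ℝ) (ha : ∀ i, i < c₁ → 0 < a i ∧ a i < 1)
    (hb : ∀ j, j < c₂ → 0 < b j ∧ b j < 1)
    (hsa : ∑ i ∈ Finset.range c₁, a i = 1) (hsb : ∑ j ∈ Finset.range c₂, b j = 1)
    (q : ℝ)
    (μ μq : Measure (Omg c₁ c₂ T)) [IsProbabilityMeasure μ] [IsProbabilityMeasure μq]
    (hμ : ∀ (n : ℕ) (w : Word c₁ c₂ T n),
      μ (cyl c₁ c₂ T n w) = ENNReal.ofReal (cylWeight c₁ c₂ T a b n w))
    (hμq : ∀ (n : ℕ) (w : Word c₁ c₂ T n),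
      μq (cyl c₁ c₂ T n w) =
        ENNReal.ofReal (cylWeight c₁ c₂ T (taW c₁ a q) (taW c₂ b q) n w))
    (ε : ℝ) (hε : 0 < ε) :
    ∀ᵐ x ∂(μq.map (gammaMap c₁ c₂ T)),
      ∀ δ : ℝ, 0 < δ → ∃ r : ℝ, 0 < r ∧ r < δ ∧
        μq.map (gammaMap c₁ c₂ T) (closedBall x r) ≤
          μ.map (gammaMap c₁ c₂ T) (closedBall x r) ^ q *
            ENNReal.ofReal r ^ (Filter.limsup (tauN c₁ c₂ T a b q) atTop - ε) := by
  have ha₀ : ∀ i < c₁, 0 < a i := fun i hi => (ha i hi).1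
  have hb₀ : ∀ j < c₂, 0 < b j := fun j hj => (hb j hj).1
  set τ := Filter.limsup (tauN c₁ c₂ T a b q) atTop
  obtain ⟨pa, hpa, hpale⟩ := exists_pos_le_forall_lt c₁ ha₀
  obtain ⟨pb, hpb, hpble⟩ := exists_pos_le_forall_lt c₂ hb₀
  set p := min pa pb
  have hp : 0 < p := lt_min hpa hpb
  obtain ⟨ra, hra, hrale⟩ := exists_pos_le_forall_lt c₁
    fun i hi => sub_pos.2 (taW_lt_one hc₁ ha₀ q i hi)
  obtain ⟨rb, hrb, hrble⟩ := exists_pos_le_forall_lt c₂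
    fun i hi => sub_pos.2 (taW_lt_one hc₂ hb₀ q i hi)
  set ρ := 1 - min ra rb
  have hρ : ρ < 1 := by simp [ρ, hra, hrb]
  have hρa : ∀ i < c₁, taW c₁ a q i ≤ ρ := fun i hi => by
    linarith [hrale i hi, min_le_left ra rb]
  have hρb : ∀ j < c₂, taW c₂ b q j ≤ ρ := fun j hj => by
    linarith [hrble j hj, min_le_right ra rb]
  set C := ((max c₁ c₂ : ℕ) : ℝ)
  have hC : 0 < C := Nat.cast_pos.2 (by omega)
  have hε2 : 0 < ε / 2 * Real.log 2 := mul_pos (half_pos hε) (Real.log_pos one_lt_two)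
  obtain ⟨K, hK⟩ := exists_nat_gt
    (max 0 ((|q| * -Real.log p + |τ - ε| * Real.log C) / (ε / 2 * Real.log 2)))
  have hK0 : 0 < K := Nat.cast_pos.1 ((le_max_left _ _).trans_lt hK)
  have hKQ : |q| * -Real.log p + |τ - ε| * Real.log C ≤ K * (ε / 2 * Real.log 2) :=
    ((div_lt_iff₀ hε2).1 ((le_max_right _ _).trans_lt hK)).le
  set bad : ℕ → Set (Omg c₁ c₂ T) := fun n =>
    digitRun c₁ c₂ T (fun _ => 0) n (n / K - 1) ∪
      digitRun c₁ c₂ T (fun i => Yc c₁ c₂ T i - 1) n (n / K - 1)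
  have hbad : Tendsto (fun n => μq (bad n)) atTop (𝓝 0) := by
    have hpow : Tendsto (fun n : ℕ => ENNReal.ofReal ρ ^ (n / K - 1)) atTop (𝓝 0) :=
      (ENNReal.tendsto_pow_atTop_nhds_zero_of_lt_one (ENNReal.ofReal_lt_one.2 hρ)).comp
        ((tendsto_sub_atTop_nat 1).comp (Nat.tendsto_div_const_atTop hK0.ne'))
    have hsum := hpow.add hpow
    rw [add_zero] at hsum
    refine tendsto_of_tendsto_of_tendsto_of_le_of_le tendsto_const_nhds hsum
      (fun _ => zero_le) fun n => (measure_union_le _ _).trans ?_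
    exact add_le_add
      (measure_digitRun_le hμq (taW_pos hc₁ ha₀ q) (taW_pos hc₂ hb₀ q) hρa hρb _ _ _)
      (measure_digitRun_le hμq (taW_pos hc₁ ha₀ q) (taW_pos hc₂ hb₀ q) hρa hρb _ _ _)
  have hfreq : ∃ᶠ n in atTop, τ - ε / 2 < tauN c₁ c₂ T a b q n :=
    frequently_lt_of_lt_limsup (isBoundedUnder_ge_tauN hc₁ hc₂ ha₀ hb₀ q).isCoboundedUnder_le
      (by linarith)
  have hγ := measurable_gammaMap (T := T) hc₁ hc₂
  have hprob := Measure.isProbabilityMeasure_map (μ := μ) hγ.aemeasurable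
  have hprobq := Measure.isProbabilityMeasure_map (μ := μq) hγ.aemeasurable
  have hball : ∀ n x, n ≠ 0 → τ - ε / 2 < tauN c₁ c₂ T a b q n → x ∉ bad n →
      μq.map (gammaMap c₁ c₂ T) (closedBall (gammaMap c₁ c₂ T x) (Dw c₁ c₂ T (n + n / K))) ≤
        μ.map (gammaMap c₁ c₂ T) (closedBall (gammaMap c₁ c₂ T x) (Dw c₁ c₂ T (n + n / K))) ^ q *
          ENNReal.ofReal (Dw c₁ c₂ T (n + n / K)) ^ (τ - ε) := by
    intro n x hn hτn hx
    set l := n / K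
    set S := gammaMap c₁ c₂ T ⁻¹' closedBall (gammaMap c₁ c₂ T x) (Dw c₁ c₂ T (n + l))
    have hmapS : ∀ m : Measure (Omg c₁ c₂ T), m.map (gammaMap c₁ c₂ T)
        (closedBall (gammaMap c₁ c₂ T x) (Dw c₁ c₂ T (n + l))) = m S := fun m =>
      Measure.map_apply hγ measurableSet_closedBall
    have hSn : S ⊆ cyl c₁ c₂ T n (truncation n x) := fun y hy =>
      mem_cyl_truncation_iff.2 (agree_of_abs_gammaMap_sub_le hc₁ hc₂
        (fun h => hx (Or.inl h)) (fun h => hx (Or.inr h))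
        (by rwa [← Real.dist_eq, dist_comm]))
    have hSm : cyl c₁ c₂ T (n + l) (truncation (n + l) x) ⊆ S := fun y hy => by
      have := abs_gammaMap_sub_le hc₁ hc₂ (mem_cyl_truncation_iff.1 hy)
      rwa [← Real.dist_eq, dist_comm] at this
    have hW := cylWeight_pos (T := T) ha₀ hb₀ n (truncation n x)
    set W := cylWeight c₁ c₂ T a b n (truncation n x)
    have hDm := Dw_pos (T := T) hc₁ hc₂ (n + l)
    have hDn := Dw_pos (T := T) hc₁ hc₂ n
    have hVW : (μ S).toReal ≤ W :=
      ENNReal.toReal_le_of_le_ofReal hW.le ((measure_mono hSn).trans_eq (hμ n _))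
    have hWV : p ^ l * W ≤ (μ S).toReal := by
      refine (pow_mul_cylWeight_le hp.le ha₀ hb₀ (fun i hi => (min_le_left _ _).trans (hpale i hi))
        (fun j hj => (min_le_right _ _).trans (hpble j hj)) n l x).trans ?_
      rw [← ENNReal.ofReal_le_iff_le_toReal (measure_ne_top μ S), ← hμ]
      exact measure_mono hSm
    have hV : 0 < (μ S).toReal := (by positivity : 0 < p ^ l * W).trans_le hWV
    have hlK : (l : ℝ) * K ≤ n := by exact_mod_cast Nat.div_mul_le_self n K
    have hmain := rpow_mul_rpow_le (q := q) (t := τ - ε) (η := ε / 2) hp hDm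
      ((Dw_strictAnti hc₁ hc₂).antitone (Nat.le_add_right n l)) (Dw_le_pow_mul hc₁ hc₂ n l) hC hW
      hWV hVW (Dw_le_half_pow hc₁ hc₂ n) (half_pos hε).le
      (by linarith : τ - ε + ε / 2 ≤ tauN c₁ c₂ T a b q n)
      (calc (l : ℝ) * (|q| * -Real.log p + |τ - ε| * Real.log C)
          ≤ l * (K * (ε / 2 * Real.log 2)) := by gcongr
        _ = l * K * (ε / 2 * Real.log 2) := by ring
        _ ≤ n * (ε / 2 * Real.log 2) := by gcongr)
    rw [hmapS, hmapS, ← ENNReal.ofReal_toReal (measure_ne_top μ S), ENNReal.ofReal_rpow_of_pos hV,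
      ENNReal.ofReal_rpow_of_pos hDm, ← ENNReal.ofReal_mul (by positivity)]
    refine (measure_mono hSn).trans ?_
    rw [hμq, cylWeight_taW ha₀ hb₀, rpow_neg_tauN hc₁ hc₂ ha₀ hb₀ q hn, Real.rpow_neg hDn.le,
      div_inv_eq_mul]
    exact ENNReal.ofReal_le_ofReal hmain
  have hae : ∀ᵐ x ∂(μq.map (gammaMap c₁ c₂ T)), ∃ᶠ n in atTop,
      μq.map (gammaMap c₁ c₂ T) (closedBall x (Dw c₁ c₂ T (n + n / K))) ≤
        μ.map (gammaMap c₁ c₂ T) (closedBall x (Dw c₁ c₂ T (n + n / K))) ^ q *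
          ENNReal.ofReal (Dw c₁ c₂ T (n + n / K)) ^ (τ - ε) := by
    refine (ae_map_iff hγ.aemeasurable ?_).2 ?_
    · simp_rw [frequently_atTop, ofPred_forall, ofPred_exists]
      refine MeasurableSet.iInter fun N => MeasurableSet.iUnion fun n =>
        (MeasurableSet.const _).inter (measurableSet_le (measurable_measure_closedBall _) ?_)
      exact ((measurable_measure_closedBall _).pow_const q).mul_const _
    · filter_upwards [ae_frequently_of_tendsto_measure_zero hbad hfreq] with x hx
      refine (hx.and_eventually (eventually_ne_atTop 0)).mono ?_
      rintro n ⟨⟨hτn, hxn⟩, hn⟩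
      exact hball n x hn hτn hxn
  have hDtend : Tendsto (fun n : ℕ => Dw c₁ c₂ T (n + n / K)) atTop (𝓝 0) :=
    squeeze_zero (fun n => (Dw_pos hc₁ hc₂ _).le)
      (fun n => ((Dw_strictAnti hc₁ hc₂).antitone (Nat.le_add_right n _)).trans
        (Dw_le_half_pow hc₁ hc₂ n))
      (tendsto_pow_atTop_nhds_zero_of_lt_one (by norm_num) (by norm_num))
  filter_upwards [hae] with x hx δ hδ
  obtain ⟨n, hn, hnδ⟩ := (hx.and_eventually (hDtend.eventually_lt_const hδ)).exists
  exact ⟨_, Dw_pos hc₁ hc₂ _, hnδ, hn⟩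

end MF
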